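/- arXiv:2410.12035 — 2 statements merged into one kernel-verified Lean document; each statement's English description precedes it below -/
import Mathlib

section
/- Let Z be a strictly positive real random variable and let η > 0. Then sup_{t>0} ( t^η · E(e^{-tZ}) ) < ∞ if and only if sup_{u>0} ( u^{-η} · P(Z ≤ u) ) < ∞. -/
open MeasureTheory Filter
open scoped ENNReal Topology

/-- Chernoff-type bound of the distribution function by the Laplace transform. -/
theorem measure_le_laplace {Ω : Type*} [MeasurableSpace Ω] (μ : Measure Ω)
    {Z : Ω → ℝ} (hZ : Measurable Z) {u : ℝ} (hu : 0 < u) :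
    μ {ω | Z ω ≤ u} ≤ ENNReal.ofReal (Real.exp 1) *
      ∫⁻ ω, ENNReal.ofReal (Real.exp (-(u⁻¹ * Z ω))) ∂μ := by
  have hs : MeasurableSet {ω | Z ω ≤ u} := measurableSet_le hZ measurable_const
  rw [← lintegral_indicator_one hs, ← lintegral_const_mul' _ _ ENNReal.ofReal_ne_top]
  refine lintegral_mono fun ω => Set.indicator_apply_le' (fun hω => ?_) fun _ => zero_le
  have hω : Z ω ≤ u := hω
  rw [Pi.one_apply, ← ENNReal.ofReal_mul (Real.exp_pos 1).le, ← Real.exp_add]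
  refine ENNReal.one_le_ofReal.2 (Real.one_le_exp ?_)
  have : u⁻¹ * Z ω ≤ 1 := by
    rw [inv_mul_le_iff₀ hu]
    linarith
  linarith

theorem ofReal_exp_neg_le_tsum {x : ℝ} (hx : 0 ≤ x) :
    ENNReal.ofReal (Real.exp (-x)) ≤
      ∑' n : ℕ, ENNReal.ofReal (Real.exp (-(n : ℝ))) * (Set.Iic ((n : ℝ) + 1)).indicator 1 x := by
  refine le_trans ?_ (ENNReal.le_tsum ⌊x⌋₊)
  rw [Set.indicator_of_mem (Set.mem_Iic.2 (Nat.lt_floor_add_one x).le), Pi.one_apply, mul_one]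
  exact ENNReal.ofReal_le_ofReal (Real.exp_le_exp.2 (neg_le_neg (Nat.floor_le hx)))

/-- The Laplace transform is bounded by a weighted sum of values of the distribution function. -/
theorem laplace_le_tsum_measure {Ω : Type*} [MeasurableSpace Ω] (μ : Measure Ω)
    {Z : Ω → ℝ} (hZ : Measurable Z) (hpos : ∀ᵐ ω ∂μ, 0 < Z ω) {t : ℝ} (ht : 0 < t) :
    ∫⁻ ω, ENNReal.ofReal (Real.exp (-(t * Z ω))) ∂μ ≤
      ∑' n : ℕ, ENNReal.ofReal (Real.exp (-(n : ℝ))) * μ {ω | Z ω ≤ ((n : ℝ) + 1) / t} := by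
  have hs (n : ℕ) : MeasurableSet {ω | Z ω ≤ ((n : ℝ) + 1) / t} :=
    measurableSet_le hZ measurable_const
  calc ∫⁻ ω, ENNReal.ofReal (Real.exp (-(t * Z ω))) ∂μ
      ≤ ∫⁻ ω, ∑' n : ℕ, ENNReal.ofReal (Real.exp (-(n : ℝ))) *
          {ω | Z ω ≤ ((n : ℝ) + 1) / t}.indicator 1 ω ∂μ := by
        refine lintegral_mono_ae ?_
        filter_upwards [hpos] with ω hω
        refine (ofReal_exp_neg_le_tsum (mul_pos ht hω).le).trans_eq (tsum_congr fun n => ?_)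
        simp only [Set.indicator_apply, Set.mem_Iic, Set.mem_ofPred_eq, le_div_iff₀' ht,
          Pi.one_apply]
    _ = _ := by
        rw [lintegral_tsum fun n =>
          ((measurable_one.indicator (hs n)).const_mul _).aemeasurable]
        refine tsum_congr fun n => ?_
        rw [lintegral_const_mul' _ _ ENNReal.ofReal_ne_top, lintegral_indicator_one (hs n)]

theorem summable_exp_neg_mul_add_one_rpow (η : ℝ) :
    Summable fun n : ℕ => Real.exp (-(n : ℝ)) * ((n : ℝ) + 1) ^ η := by
  have h := ((summable_nat_add_iff 1).2
    (Real.summable_pow_mul_exp_neg_nat_mul ⌈η⌉₊ one_pos)).mul_left (Real.exp 1)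
  refine h.of_nonneg_of_le (fun n => by positivity) fun n => ?_
  have h1 : ((n : ℝ) + 1) ^ η ≤ ((n : ℝ) + 1) ^ ⌈η⌉₊ := by
    rw [← Real.rpow_natCast]
    exact Real.rpow_le_rpow_of_exponent_le (by linarith [n.cast_nonneg (α := ℝ)]) (Nat.le_ceil η)
  have h2 : Real.exp (-(n : ℝ)) = Real.exp 1 * Real.exp (-1 * ((n + 1 : ℕ) : ℝ)) := by
    rw [← Real.exp_add]
    push_cast
    ring_nf
  rw [h2]
  push_cast
  calc _ ≤ Real.exp 1 * Real.exp (-1 * ((n : ℝ) + 1)) * ((n : ℝ) + 1) ^ ⌈η⌉₊ := by gcongr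
    _ = _ := by ring

/-- For a strictly positive real random variable `Z` and `η > 0`,
`sup_{t>0} t^η E(e^{-tZ}) < ∞` iff `sup_{u>0} u^{-η} P(Z ≤ u) < ∞`. -/
theorem stmt1
    {Ω : Type*} [MeasurableSpace Ω] (μ : Measure Ω) [IsProbabilityMeasure μ]
    (Z : Ω → ℝ) (hZmeas : Measurable Z) (hZpos : ∀ᵐ ω ∂μ, 0 < Z ω)
    (η : ℝ) (hη : 0 < η) :
    (⨆ t ∈ Set.Ioi (0 : ℝ),
        ENNReal.ofReal (t ^ η) * ∫⁻ ω, ENNReal.ofReal (Real.exp (-(t * Z ω))) ∂μ) < ⊤ ↔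
    (⨆ u ∈ Set.Ioi (0 : ℝ),
        ENNReal.ofReal (u ^ (-η)) * μ {ω | Z ω ≤ u}) < ⊤ := by
  constructor
  · intro h
    refine lt_of_le_of_lt (iSup₂_le fun u hu => ?_)
      (ENNReal.mul_lt_top (ENNReal.ofReal_lt_top (r := Real.exp 1)) h)
    have hu : 0 < u := hu
    calc ENNReal.ofReal (u ^ (-η)) * μ {ω | Z ω ≤ u}
        ≤ ENNReal.ofReal (u ^ (-η)) * (ENNReal.ofReal (Real.exp 1) *
          ∫⁻ ω, ENNReal.ofReal (Real.exp (-(u⁻¹ * Z ω))) ∂μ) := by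
          gcongr
          exact measure_le_laplace μ hZmeas hu
      _ = ENNReal.ofReal (Real.exp 1) * (ENNReal.ofReal (u⁻¹ ^ η) *
          ∫⁻ ω, ENNReal.ofReal (Real.exp (-(u⁻¹ * Z ω))) ∂μ) := by
          rw [Real.rpow_neg_eq_inv_rpow, mul_left_comm]
      _ ≤ _ := by
          gcongr
          exact le_iSup₂ (f := fun (t : ℝ) (_ : t ∈ Set.Ioi (0 : ℝ)) => ENNReal.ofReal (t ^ η) *
            ∫⁻ ω, ENNReal.ofReal (Real.exp (-(t * Z ω))) ∂μ) u⁻¹ (inv_pos.2 hu)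
  · intro h
    set C := ⨆ u ∈ Set.Ioi (0 : ℝ), ENNReal.ofReal (u ^ (-η)) * μ {ω | Z ω ≤ u}
    refine lt_of_le_of_lt (iSup₂_le fun t ht => ?_) (ENNReal.mul_lt_top
      (summable_exp_neg_mul_add_one_rpow η).tsum_ofReal_lt_top h)
    have ht : 0 < t := ht
    calc ENNReal.ofReal (t ^ η) * ∫⁻ ω, ENNReal.ofReal (Real.exp (-(t * Z ω))) ∂μ
        ≤ ENNReal.ofReal (t ^ η) * ∑' n : ℕ, ENNReal.ofReal (Real.exp (-(n : ℝ))) *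
          μ {ω | Z ω ≤ ((n : ℝ) + 1) / t} := by
          gcongr
          exact laplace_le_tsum_measure μ hZmeas hZpos ht
      _ ≤ _ := by
          rw [← ENNReal.tsum_mul_left, ← ENNReal.tsum_mul_right]
          refine ENNReal.tsum_le_tsum fun n => ?_
          have hn : (0 : ℝ) < (n : ℝ) + 1 := by positivity
          have hle : ENNReal.ofReal ((((n : ℝ) + 1) / t) ^ (-η)) *
              μ {ω | Z ω ≤ ((n : ℝ) + 1) / t} ≤ C :=
            le_iSup₂ (f := fun (u : ℝ) (_ : u ∈ Set.Ioi (0 : ℝ)) =>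
              ENNReal.ofReal (u ^ (-η)) * μ {ω | Z ω ≤ u}) (((n : ℝ) + 1) / t) (div_pos hn ht)
          have hpow : t ^ η = ((n : ℝ) + 1) ^ η * (((n : ℝ) + 1) / t) ^ (-η) := by
            rw [Real.rpow_neg_eq_inv_rpow, ← Real.mul_rpow hn.le (by positivity)]
            congr 1
            field_simp
          rw [hpow, ENNReal.ofReal_mul (by positivity), ENNReal.ofReal_mul (by positivity)]
          refine le_trans (le_of_eq ?_) (mul_le_mul_right hle _)
          ring
end

section
/- Let Z be a standard normal random variable and let Φ denote the standard normal cumulative distribution function. There exists a universal constant C > 0 such that for all real numbers s and σ with σ ≥ 2s ≥ 1, ( E( e^{σ(Z − s)} · 1_{\{Z ≤ s\}} ) / Φ(s) ) / ( 1 − Φ(s) ) ≤ C · s / σ. -/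
open MeasureTheory ProbabilityTheory
open scoped ENNReal NNReal

lemma gaussianPDFReal_zero_one_eq_mul_exp (s x : ℝ) :
    gaussianPDFReal 0 1 x = gaussianPDFReal 0 1 s * Real.exp ((s ^ 2 - x ^ 2) / 2) := by
  simp only [gaussianPDFReal_def, sub_zero, NNReal.coe_one, mul_one]
  rw [mul_assoc, ← Real.exp_add]
  congr 2
  ring

/-- The exponential moment of a standard normal variable on `(-∞, s]`, bounded by replacing the
Gaussian density with its log-linear tangent majorant at `s`. -/
lemma setIntegral_Iic_exp_gaussianReal_le {s σ : ℝ} (h : s < σ) :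
    ∫ x in Set.Iic s, Real.exp (σ * (x - s)) ∂(gaussianReal 0 1) ≤
      gaussianPDFReal 0 1 s / (σ - s) := by
  have hpos : 0 < σ - s := sub_pos.2 h
  have hp : 0 ≤ gaussianPDFReal 0 1 s := gaussianPDFReal_nonneg _ _ _
  rw [gaussianReal_of_var_ne_zero _ one_ne_zero,
    setIntegral_withDensity_eq_setIntegral_toReal_smul (measurable_gaussianPDF _ _)
      (ae_of_all _ fun _ ↦ gaussianPDF_lt_top) _ measurableSet_Iic]
  simp only [toReal_gaussianPDF, smul_eq_mul]
  calc ∫ x in Set.Iic s, gaussianPDFReal 0 1 x * Real.exp (σ * (x - s))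
      ≤ ∫ x in Set.Iic s, gaussianPDFReal 0 1 s * Real.exp (-((σ - s) * s)) *
          Real.exp ((σ - s) * x) := by
        refine integral_mono_of_nonneg (ae_of_all _ fun x ↦ ?_)
          ((integrableOn_exp_mul_Iic hpos s).const_mul _) (ae_of_all _ fun x ↦ ?_)
        · exact mul_nonneg (gaussianPDFReal_nonneg _ _ _) (Real.exp_pos _).le
        · simp only
          rw [gaussianPDFReal_zero_one_eq_mul_exp s x, mul_assoc, mul_assoc, ← Real.exp_add,
            ← Real.exp_add]
          refine mul_le_mul_of_nonneg_left (Real.exp_le_exp.2 ?_) hp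
          nlinarith [sq_nonneg (x - s)]
    _ = gaussianPDFReal 0 1 s / (σ - s) := by
        rw [integral_const_mul, integral_exp_mul_Iic hpos, mul_assoc, ← mul_div_assoc,
          ← Real.exp_add, neg_add_cancel, Real.exp_zero, mul_one_div]

/-- A Mills-ratio lower bound for the standard normal tail. -/
lemma le_one_sub_gaussianReal_Iic {s : ℝ} (hs : 1 / 2 ≤ s) :
    gaussianPDFReal 0 1 s * Real.exp (-3) / s ≤
      1 - ((gaussianReal 0 1) (Set.Iic s)).toReal := by
  have hs0 : 0 < s := by linarith
  have hp : 0 ≤ gaussianPDFReal 0 1 s := gaussianPDFReal_nonneg _ _ _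
  have hinv : 1 / s ≤ 2 := by rw [div_le_iff₀ hs0]; linarith
  have hinv0 : 0 < 1 / s := by positivity
  have hmul : s * (1 / s) = 1 := by field_simp
  calc gaussianPDFReal 0 1 s * Real.exp (-3) / s
      = gaussianPDFReal 0 1 s * Real.exp (-3) *
          volume.real (Set.Ioc s (s + 1 / s)) := by
        rw [Real.volume_real_Ioc_of_le (by linarith), add_sub_cancel_left, mul_one_div]
    _ ≤ ∫ x in Set.Ioc s (s + 1 / s), gaussianPDFReal 0 1 x := by
        refine setIntegral_ge_of_const_le_real measurableSet_Ioc (by simp) (fun x hx ↦ ?_)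
          (integrable_gaussianPDFReal _ _).integrableOn
        rw [gaussianPDFReal_zero_one_eq_mul_exp s x]
        refine mul_le_mul_of_nonneg_left (Real.exp_le_exp.2 ?_) hp
        have h1 : x ^ 2 ≤ (s + 1 / s) ^ 2 := pow_le_pow_left₀ (by linarith [hx.1]) hx.2 2
        nlinarith
    _ = (gaussianReal 0 1).real (Set.Ioc s (s + 1 / s)) := by
        rw [measureReal_def, gaussianReal_apply_eq_integral _ one_ne_zero,
          ENNReal.toReal_ofReal (integral_nonneg fun x ↦ gaussianPDFReal_nonneg _ _ x)]
    _ ≤ (gaussianReal 0 1).real (Set.Iic s)ᶜ := by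
        refine measureReal_mono fun x hx ↦ ?_
        simpa using hx.1
    _ = 1 - ((gaussianReal 0 1) (Set.Iic s)).toReal := by
        rw [probReal_compl_eq_one_sub measurableSet_Iic, measureReal_def]

/-- There is a universal constant `C > 0` such that, for all reals `s, σ` with `σ ≥ 2s ≥ 1`,
`E(e^{σ(Z−s)} | Z ≤ s) / (1 − Φ(s)) ≤ C s/σ`, where `Z` is standard normal. -/
theorem stmt15 :
    ∃ C : ℝ, 0 < C ∧ ∀ s σ : ℝ, 1 ≤ 2 * s → 2 * s ≤ σ →
      ((∫ x in Set.Iic s, Real.exp (σ * (x - s)) ∂(gaussianReal 0 1)) /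
          ((gaussianReal 0 1) (Set.Iic s)).toReal) /
        (1 - ((gaussianReal 0 1) (Set.Iic s)).toReal) ≤ C * s / σ := by
  set c : ℝ := ((gaussianReal 0 1) (Set.Iic (0 : ℝ))).toReal
  have hc0 : 0 < c := by
    refine ENNReal.toReal_pos (fun h ↦ ?_) (measure_ne_top _ _)
    simpa using gaussianReal_absolutelyContinuous' 0 one_ne_zero h
  refine ⟨2 * Real.exp 3 / c, by positivity, fun s σ hs hσ ↦ ?_⟩
  have hs0 : 0 < s := by linarith
  have hσ0 : 0 < σ := by linarith
  have hp : 0 < gaussianPDFReal 0 1 s := gaussianPDFReal_pos _ _ _ one_ne_zero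
  have hΦ : c ≤ ((gaussianReal 0 1) (Set.Iic s)).toReal :=
    ENNReal.toReal_mono (measure_ne_top _ _) (measure_mono (Set.Iic_subset_Iic.2 hs0.le))
  have hnum : ∫ x in Set.Iic s, Real.exp (σ * (x - s)) ∂(gaussianReal 0 1) ≤
      gaussianPDFReal 0 1 s / (σ / 2) :=
    (setIntegral_Iic_exp_gaussianReal_le (by linarith)).trans
      (div_le_div_of_nonneg_left hp.le (by positivity) (by linarith))
  have htail := le_one_sub_gaussianReal_Iic (s := s) (by linarith)
  calc _ ≤ (gaussianPDFReal 0 1 s / (σ / 2) / c) / (gaussianPDFReal 0 1 s * Real.exp (-3) / s) := by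
        gcongr
    _ = 2 * Real.exp 3 / c * s / σ := by
        rw [Real.exp_neg]
        field_simp
end
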